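/- Let p be a prime and f : {0,1}^n → {0,1} a non-trivial symmetric Boolean function. Then deg_p(f) ≥ min{ n/2, (1 − 1/p)·π_p(f) }, where π_p(f) is the base-p period of f. -/

import Mathlib

/-- Hamming weight of a Boolean input. -/
def wt {n : ℕ} (x : Fin n → Bool) : ℕ :=
  (Finset.univ.filter fun i => x i = true).card

/-- Coefficient of the monomial `∏_{i ∈ S} x_i` in the unique multilinear polynomial over
`ℤ_m` representing the Boolean function `f`, obtained by Möbius inversion. -/
def modCoeff (m n : ℕ) (f : (Fin n → Bool) → Bool) (S : Finset (Fin n)) : ZMod m :=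
  ∑ T ∈ S.powerset, (-1 : ZMod m) ^ (S.card - T.card) * (if f (fun i => decide (i ∈ T)) then 1 else 0)

/-- The modulo-`m` degree of a Boolean function: the total degree of the unique multilinear
polynomial over `ℤ_m` representing it. -/
def modDeg (m n : ℕ) (f : (Fin n → Bool) → Bool) : ℕ :=
  ((Finset.univ : Finset (Finset (Fin n))).filter fun S => modCoeff m n f S ≠ 0).sup Finset.card

/-- A Boolean function is symmetric if its value depends only on the Hamming weight. -/
def SymmetricBF {n : ℕ} (f : (Fin n → Bool) → Bool) : Prop :=
  ∀ x y, wt x = wt y → f x = f y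

/-- A Boolean function is non-trivial if it is not constant. -/
def NontrivialBF {n : ℕ} (f : (Fin n → Bool) → Bool) : Prop :=
  ∃ x y, f x ≠ f y

/-- A symmetric Boolean function is `ℓ`-periodic if its univariate version takes equal values
on arguments that agree modulo `ℓ`. -/
def PeriodicBF {n : ℕ} (ℓ : ℕ) (f : (Fin n → Bool) → Bool) : Prop :=
  ∀ x y : Fin n → Bool, wt x % ℓ = wt y % ℓ → f x = f y

/-- A Boolean function is non-degenerate if every coordinate is sensitive on some input. -/
def NondegenerateBF {n : ℕ} (f : (Fin n → Bool) → Bool) : Prop :=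
  ∀ i : Fin n, ∃ x, f x ≠ f (Function.update x i (!x i))

open Finset Polynomial in
theorem exists_eq_C_of_eval_boolean {p : ℕ} [Fact p.Prime] (Q : (ZMod p)[X]) (e : ℕ)
    (hQ : Q.natDegree ≤ e) (he : e < p - 1)
    (hbool : ∀ b : ℕ, b ≤ 2 * e → Q.eval (b : ZMod p) = 0 ∨ Q.eval (b : ZMod p) = 1) :
    ∃ c, Q = C c := by
  have hp := (Fact.out : p.Prime).two_le
  rcases lt_or_ge (2 * e) p with h | h
  · have hzero : Q * (Q - 1) = 0 := by
      refine eq_zero_of_natDegree_lt_card_of_eval_eq_zero (ι := Fin (2 * e + 1)) _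
        (f := fun i => ((i : ℕ) : ZMod p)) ?_ ?_ ?_
      · intro i j hij
        have hij : ((i : ℕ) : ZMod p) = ((j : ℕ) : ZMod p) := hij
        rw [ZMod.natCast_eq_natCast_iff', Nat.mod_eq_of_lt (by omega),
          Nat.mod_eq_of_lt (by omega)] at hij
        exact Fin.ext hij
      · intro i
        rcases hbool i (by omega) with h | h <;> simp [h]
      · have h1 : (Q * (Q - 1)).natDegree ≤ Q.natDegree + (Q - 1).natDegree := natDegree_mul_le
        have h2 : (Q - 1).natDegree ≤ Q.natDegree := by
          simpa using natDegree_sub_le Q 1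
        simp only [Fintype.card_fin]
        omega
    rcases mul_eq_zero.1 hzero with h | h
    · exact ⟨0, by simpa using h⟩
    · exact ⟨1, by simpa using sub_eq_zero.1 h⟩
  · have hall : ∀ x : ZMod p, Q.eval x = 0 ∨ Q.eval x = 1 := by
      intro x
      have := hbool x.val (by have := x.val_lt; omega)
      simpa using this
    have hsum : ∑ x : ZMod p, Q.eval x = 0 := by
      simp only [eval_eq_sum_range]
      rw [sum_comm]
      refine sum_eq_zero fun i hi => ?_
      rw [← mul_sum, FiniteField.sum_pow_lt_card_sub_one, mul_zero]
      rw [ZMod.card]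
      have := mem_range.1 hi
      omega
    have hcard : ((univ.filter fun x : ZMod p => Q.eval x = 1).card : ZMod p) = 0 := by
      rw [← hsum, card_filter, Nat.cast_sum]
      refine sum_congr rfl fun x _ => ?_
      rcases hall x with h | h <;> simp [h]
    rw [ZMod.natCast_eq_zero_iff] at hcard
    have hle : (univ.filter fun x : ZMod p => Q.eval x = 1).card ≤ p := by
      simpa using card_le_univ (univ.filter fun x : ZMod p => Q.eval x = 1)
    have hconst : ∃ c, ∀ x, Q.eval x = c := by
      obtain ⟨k, hk⟩ := hcard
      have hk1 : k ≤ 1 := by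
        by_contra! hk1
        nlinarith
      interval_cases k
      · refine ⟨0, fun x => (hall x).resolve_right fun hx => ?_⟩
        simp [filter_eq_empty_iff] at hk
        exact hk hx
      · refine ⟨1, fun x => ?_⟩
        have := (card_eq_iff_eq_univ (univ.filter fun x : ZMod p => Q.eval x = 1)).1
          (by simpa using hk)
        simpa using this.ge (mem_univ x)
    obtain ⟨c, hc⟩ := hconst
    refine ⟨c, sub_eq_zero.1 ?_⟩
    refine eq_zero_of_natDegree_lt_card_of_eval_eq_zero (ι := ZMod p) _
      (f := id) Function.injective_id (by simp [hc]) ?_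
    rw [natDegree_sub_C, ZMod.card]
    omega

open Finset in
theorem eq_zero_of_sum_mul_choose_eq_zero {R : Type*} [Ring R] (r : ℕ → R) (e N : ℕ) (heN : e < N)
    (h : ∀ b ≤ e, ∑ j ∈ range N, r j * (b.choose j : R) = 0) : ∀ j ≤ e, r j = 0 := by
  intro j
  induction j using Nat.strong_induction_on with
  | _ j ih =>
    intro hj
    have := h j hj
    rw [sum_eq_single j] at this
    · simpa using this
    · intro i _ hij
      rcases lt_or_gt_of_ne hij with hlt | hgt
      · rw [ih i hlt (by omega), zero_mul]
      · rw [Nat.choose_eq_zero_of_lt hgt, Nat.cast_zero, mul_zero]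
    · intro hj'
      simp at hj'
      omega

open Finset Polynomial in
theorem eq_zero_of_sum_mul_choose_boolean {p : ℕ} [Fact p.Prime] (q : ℕ → ZMod p) (e : ℕ)
    (he0 : 1 ≤ e) (he : e < p - 1)
    (hbool : ∀ b ≤ 2 * e, ∑ j ∈ range (e + 1), q j * (b.choose j : ZMod p) = 0 ∨
      ∑ j ∈ range (e + 1), q j * (b.choose j : ZMod p) = 1) :
    q e = 0 := by
  set Q : (ZMod p)[X] :=
    ∑ j ∈ range (e + 1), C (q j * ((j.factorial : ZMod p))⁻¹) * descPochhammer (ZMod p) j with hQdef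
  have hQ : ∀ b : ℕ, Q.eval (b : ZMod p) = ∑ j ∈ range (e + 1), q j * (b.choose j : ZMod p) := by
    intro b
    rw [hQdef, eval_finsetSum]
    refine sum_congr rfl fun j hj => ?_
    have hj := mem_range.1 hj
    have hfac : (j.factorial : ZMod p) ≠ 0 := by
      rw [Ne, ZMod.natCast_eq_zero_iff, (Fact.out : p.Prime).dvd_factorial]
      omega
    rw [eval_mul, eval_C, descPochhammer_eval_eq_descFactorial,
      Nat.descFactorial_eq_factorial_mul_choose, Nat.cast_mul]
    field_simp
  have hdeg : Q.natDegree ≤ e := by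
    refine natDegree_sum_le_of_forall_le _ _ fun j hj => ?_
    have hj := mem_range.1 hj
    refine (natDegree_C_mul_le _ _).trans ?_
    rw [descPochhammer_natDegree]
    omega
  obtain ⟨c, hc⟩ := exists_eq_C_of_eval_boolean Q e hdeg he (by simpa only [hQ] using hbool)
  have := eq_zero_of_sum_mul_choose_eq_zero (fun j => q j - if j = 0 then c else 0) e (e + 1)
    (by omega) (fun b _ => by
      simp only [sub_mul, sum_sub_distrib, ← hQ, hc]
      simp) e le_rfl
  simpa [show e ≠ 0 by omega] using this

theorem choose_cast_zmod_prime_pow (p : ℕ) [Fact p.Prime] (s n k : ℕ) :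
    (n.choose k : ZMod p) = ((n % p ^ s).choose (k % p ^ s) : ZMod p) *
      ((n / p ^ s).choose (k / p ^ s) : ZMod p) := by
  have lucas : ∀ n k : ℕ, (n.choose k : ZMod p) =
      ((n % p).choose (k % p) : ZMod p) * ((n / p).choose (k / p) : ZMod p) := by
    intro n k
    rw [← Nat.cast_mul, ZMod.natCast_eq_natCast_iff]
    exact Choose.choose_modEq_choose_mod_mul_choose_div_nat
  induction s generalizing n k with
  | zero => simp [Nat.mod_one]
  | succ s ih =>
    rw [lucas n k, ih (n / p) (k / p), lucas (n % p ^ (s + 1)) (k % p ^ (s + 1))]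
    simp only [pow_succ', Nat.mod_mul_right_mod, Nat.mod_mul_right_div_self, Nat.div_div_eq_div_mul]
    ring

open Finset in
theorem sum_range_mul_eq {M : Type*} [AddCommMonoid M] (g : ℕ → M) (L N : ℕ) :
    ∑ j ∈ range (L * N), g j = ∑ J ∈ range N, ∑ i ∈ range L, g (L * J + i) := by
  induction N with
  | zero => simp
  | succ N ih => rw [mul_add, mul_one, sum_range_add, ih, sum_range_succ]

open Finset in
theorem coeff_eq_zero_of_boolean {p : ℕ} [Fact p.Prime] (s d n : ℕ) (c : ℕ → ZMod p)
    (hc : ∀ j, d < j → c j = 0) (hLd : p ^ s ≤ d) (hdL : d < (p - 1) * p ^ s) (hn : 2 * d ≤ n)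
    (hbool : ∀ k ≤ n, ∑ j ∈ range (d + 1), c j * (k.choose j : ZMod p) = 0 ∨
      ∑ j ∈ range (d + 1), c j * (k.choose j : ZMod p) = 1) :
    c d = 0 := by
  set L := p ^ s with hL
  have hL0 : 0 < L := pow_pos (Fact.out : p.Prime).pos s
  set e := d / L with he
  have hde : L * e + d % L = d := Nat.div_add_mod d L
  have hmod : d % L < L := Nat.mod_lt _ hL0
  have hexp : ∀ a < L, ∀ b, ∑ j ∈ range (d + 1), c j * ((a + L * b).choose j : ZMod p) =
      ∑ J ∈ range (e + 1), (∑ i ∈ range L, c (L * J + i) * (a.choose i : ZMod p)) *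
        (b.choose J : ZMod p) := by
    intro a ha b
    rw [sum_subset (range_subset_range.2 (show d + 1 ≤ L * (e + 1) by rw [mul_add]; omega)),
      sum_range_mul_eq]
    · refine sum_congr rfl fun J _ => ?_
      rw [sum_mul]
      refine sum_congr rfl fun i hi => ?_
      have hi := mem_range.1 hi
      rw [choose_cast_zmod_prime_pow p s, ← hL, Nat.add_mul_mod_self_left, Nat.mul_add_mod,
        Nat.mod_eq_of_lt ha, Nat.mod_eq_of_lt hi, Nat.add_mul_div_left _ _ hL0,
        Nat.mul_add_div hL0, Nat.div_eq_of_lt ha, Nat.div_eq_of_lt hi, zero_add, add_zero]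
      ring
    · intro j _ hj
      rw [hc j (by simpa using hj), zero_mul]
  have htop : ∀ a ≤ d % L, ∑ i ∈ range L, c (L * e + i) * (a.choose i : ZMod p) = 0 := by
    intro a ha
    refine eq_zero_of_sum_mul_choose_boolean
      (fun J => ∑ i ∈ range L, c (L * J + i) * (a.choose i : ZMod p)) e
      ((Nat.one_le_div_iff hL0).2 hLd) ((Nat.div_lt_iff_lt_mul hL0).2 hdL) fun b hb => ?_
    simp only [← hexp a (by omega) b]
    refine hbool _ ?_
    have : L * b ≤ L * (2 * e) := Nat.mul_le_mul_left _ hb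
    have : L * (2 * e) = 2 * (L * e) := by ring
    omega
  have := eq_zero_of_sum_mul_choose_eq_zero (fun i => c (L * e + i)) (d % L) L hmod htop _ le_rfl
  simpa only [hde] using this

/-- The univariate version of `f`, with values in `ZMod m`: its value at `k` is the value of `f` at
the input whose first `k` coordinates are set. -/
def univariate (m : ℕ) {n : ℕ} (f : (Fin n → Bool) → Bool) (k : ℕ) : ZMod m :=
  if f (fun i => decide ((i : ℕ) < k)) then 1 else 0

theorem wt_decide_mem {n : ℕ} (T : Finset (Fin n)) : wt (fun i => decide (i ∈ T)) = T.card := by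
  simp [wt]

theorem wt_le {n : ℕ} (x : Fin n → Bool) : wt x ≤ n := by
  simpa [wt] using Finset.card_le_univ (Finset.univ.filter fun i => x i = true)

theorem wt_decide_lt {n k : ℕ} (hk : k ≤ n) : wt (fun i : Fin n => decide ((i : ℕ) < k)) = k := by
  simp [wt, Fin.card_filter_val_lt, hk]

theorem univariate_wt (m : ℕ) {n : ℕ} {f : (Fin n → Bool) → Bool} (hsym : SymmetricBF f)
    (x : Fin n → Bool) : univariate m f (wt x) = if f x then 1 else 0 := by
  rw [univariate, hsym _ x (wt_decide_lt (wt_le x))]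

theorem modCoeff_eq_fwdDiff (m : ℕ) {n : ℕ} {f : (Fin n → Bool) → Bool} (hsym : SymmetricBF f)
    (S : Finset (Fin n)) : modCoeff m n f S = (fwdDiff 1)^[S.card] (univariate m f) 0 := by
  rw [fwdDiff_iter_eq_sum_shift, modCoeff]
  have : ∀ T ∈ S.powerset, (-1 : ZMod m) ^ (S.card - T.card) *
      (if f (fun i => decide (i ∈ T)) then 1 else 0) =
      (fun k => (-1 : ZMod m) ^ (S.card - k) * univariate m f k) T.card := fun T _ => by
    simp only [← univariate_wt m hsym, wt_decide_mem]
  rw [Finset.sum_congr rfl this, Finset.sum_powerset_apply_card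
    (fun k => (-1 : ZMod m) ^ (S.card - k) * univariate m f k)]
  refine Finset.sum_congr rfl fun k _ => ?_
  simp
  ring

theorem modCoeff_eq_zero_of_modDeg_lt {m n : ℕ} {f : (Fin n → Bool) → Bool} {S : Finset (Fin n)}
    (h : modDeg m n f < S.card) : modCoeff m n f S = 0 := by
  by_contra hS
  exact h.not_ge (Finset.le_sup (f := Finset.card) (Finset.mem_filter.2 ⟨Finset.mem_univ S, hS⟩))

theorem exists_modCoeff_ne_zero {m n : ℕ} {f : (Fin n → Bool) → Bool} (h : 0 < modDeg m n f) :
    ∃ S : Finset (Fin n), S.card = modDeg m n f ∧ modCoeff m n f S ≠ 0 := by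
  have hne : ((Finset.univ : Finset (Finset (Fin n))).filter
      fun S => modCoeff m n f S ≠ 0).Nonempty := by
    by_contra hne
    rw [Finset.not_nonempty_iff_eq_empty] at hne
    simp [modDeg, hne] at h
  obtain ⟨S, hS, hcard⟩ := Finset.exists_mem_eq_sup _ hne Finset.card
  exact ⟨S, hcard.symm, (Finset.mem_filter.1 hS).2⟩

open Finset in
theorem univariate_eq_sum (m : ℕ) {n : ℕ} {f : (Fin n → Bool) → Bool} (hsym : SymmetricBF f)
    {k : ℕ} (hk : k ≤ n) :
    univariate m f k = ∑ j ∈ range (modDeg m n f + 1),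
      (fwdDiff 1)^[j] (univariate m f) 0 * (k.choose j : ZMod m) := by
  have h := shift_eq_sum_fwdDiff_iter 1 (univariate m f) k 0
  simp only [zero_add, smul_eq_mul, mul_one, nsmul_eq_mul] at h
  rw [h]
  have hext : ∀ N N', N ≤ N' → (∀ j, N ≤ j → j < N' →
      (fwdDiff 1)^[j] (univariate m f) 0 * (k.choose j : ZMod m) = 0) →
      ∑ j ∈ range N, (fwdDiff 1)^[j] (univariate m f) 0 * (k.choose j : ZMod m) =
      ∑ j ∈ range N', (fwdDiff 1)^[j] (univariate m f) 0 * (k.choose j : ZMod m) := by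
    intro N N' hN hz
    refine sum_subset (range_subset_range.2 hN) fun j hj hj' => hz j ?_ (mem_range.1 hj)
    simpa using hj'
  simp only [mul_comm (Nat.cast (Nat.choose _ _) : ZMod m)]
  rw [hext (k + 1) (k + modDeg m n f + 1) (by omega),
    hext (modDeg m n f + 1) (k + modDeg m n f + 1) (by omega)]
  · intro j hj _
    rcases le_or_gt j k with hjk | hjk
    · obtain ⟨S, -, hS⟩ := exists_subset_card_eq (s := (univ : Finset (Fin n))) (n := j)
        (by simp; omega)
      rw [← hS, ← modCoeff_eq_fwdDiff m hsym, modCoeff_eq_zero_of_modDeg_lt (by omega), zero_mul]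
    · rw [Nat.choose_eq_zero_of_lt hjk, Nat.cast_zero, mul_zero]
  · intro j hj _
    rw [Nat.choose_eq_zero_of_lt (by omega), Nat.cast_zero, mul_zero]

theorem periodicBF_of_modDeg_lt {p n s : ℕ} [Fact p.Prime] {f : (Fin n → Bool) → Bool}
    (hsym : SymmetricBF f) (h : modDeg p n f < p ^ s) : PeriodicBF (p ^ s) f := by
  intro x y hxy
  have heq : univariate p f (wt x) = univariate p f (wt y) := by
    rw [univariate_eq_sum p hsym (wt_le x), univariate_eq_sum p hsym (wt_le y)]
    refine Finset.sum_congr rfl fun j hj => ?_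
    have hj : j < p ^ s := by have := Finset.mem_range.1 hj; omega
    rw [choose_cast_zmod_prime_pow p s (wt x), choose_cast_zmod_prime_pow p s (wt y), hxy,
      Nat.div_eq_of_lt hj]
    simp
  rw [univariate_wt p hsym, univariate_wt p hsym] at heq
  cases hx : f x <;> cases hy : f y <;> simp_all

/-- A non-trivial symmetric Boolean function with base-`p` period `p^t`
satisfies `deg_p(f) ≥ min{n/2, (1 − 1/p)·p^t}`. -/
theorem stmt14 (p t n : ℕ) (hp : p.Prime)
    (f : (Fin n → Bool) → Bool) (hsym : SymmetricBF f) (hnt : NontrivialBF f)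
    (hper : PeriodicBF (p ^ t) f) (hmin : ∀ s < t, ¬ PeriodicBF (p ^ s) f) :
    min ((n : ℚ) / 2) ((1 - 1 / (p : ℚ)) * (p : ℚ) ^ t) ≤ (modDeg p n f : ℚ) := by
  have : Fact p.Prime := ⟨hp⟩
  obtain _ | s := t
  · obtain ⟨x, y, hxy⟩ := hnt
    exact absurd (hper x y (by simp [Nat.mod_one])) hxy
  by_contra! hlt
  obtain ⟨hlt₁, hlt₂⟩ := lt_min_iff.1 hlt
  have hn : 2 * modDeg p n f ≤ n := by
    have : (2 * modDeg p n f : ℚ) ≤ n := by linarith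
    exact_mod_cast this
  have hdL : modDeg p n f < (p - 1) * p ^ s := by
    have hp0 : (p : ℚ) ≠ 0 := by exact_mod_cast hp.ne_zero
    have heq : (1 - 1 / (p : ℚ)) * (p : ℚ) ^ (s + 1) = (((p - 1) * p ^ s : ℕ) : ℚ) := by
      rw [Nat.cast_mul, Nat.cast_sub hp.one_le, Nat.cast_pow, pow_succ]
      field_simp
      simp
    rw [heq] at hlt₂
    exact_mod_cast hlt₂
  have hLd : p ^ s ≤ modDeg p n f := by
    by_contra! h
    exact hmin s s.lt_succ_self (periodicBF_of_modDeg_lt hsym h)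
  obtain ⟨S, hS, hne⟩ := exists_modCoeff_ne_zero ((pow_pos hp.pos s).trans_le hLd)
  rw [modCoeff_eq_fwdDiff p hsym, hS] at hne
  refine hne ?_
  have hzero := coeff_eq_zero_of_boolean s (modDeg p n f) n
    (fun j => if j ≤ modDeg p n f then (fwdDiff 1)^[j] (univariate p f) 0 else 0)
    (fun j hj => if_neg hj.not_ge) hLd hdL hn fun k hk => by
      have hsum := univariate_eq_sum p hsym hk
      rw [Finset.sum_congr rfl fun j hj => by
        rw [if_pos (Nat.lt_succ_iff.1 (Finset.mem_range.1 hj))], ← hsum, univariate]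
      split_ifs <;> simp
  simpa using hzero
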